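/- arXiv:1410.3809 — 2 statements merged into one kernel-verified Lean document; each statement's English description precedes it below -/
import Mathlib

section
/- Under the generalized Minkowski curvature flow, if A(t) > 0 for all t, the isoperimetric ratio evolves by d/dt (L(t)²/A(t)) = −(2L(t)/A(t))·( ∫₀^{2π} k(u,t)² v(u,t) du − A(𝒫_t)·L(t)/A(t) ) + (2L(t)/A(t))·∫₀^{2π} (∂/∂t log a)(θ(u,t),t)·v(u,t) du, where L(t) := ∫₀^{2π} v(u,t) du is the 𝒬_t-length, A(t) := (1/2)∫₀^{2π}[F(u,t), ∂F/∂u(u,t)] du, and A(𝒫_t) := (1/2)∫₀^{2π} a(θ,t)(a(θ,t)+a''(θ,t)) dθ. -/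
open Real Set

noncomputable def wedge (x y : ℝ × ℝ) : ℝ := x.1 * y.2 - x.2 * y.1

noncomputable def er (θ : ℝ) : ℝ × ℝ := (Real.cos θ, Real.sin θ)

noncomputable def etheta (θ : ℝ) : ℝ × ℝ := (-Real.sin θ, Real.cos θ)

/-- partial derivative in the first (spatial) variable -/
noncomputable def pd (f : ℝ → ℝ → ℝ) (θ t : ℝ) : ℝ := deriv (fun x => f x t) θ

/-- partial derivative in the second (time) variable -/
noncomputable def pt (f : ℝ → ℝ → ℝ) (θ t : ℝ) : ℝ := deriv (fun s => f θ s) t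

/-- partial derivative in the first variable, vector valued -/
noncomputable def pdv (f : ℝ → ℝ → ℝ × ℝ) (θ t : ℝ) : ℝ × ℝ := deriv (fun x => f x t) θ

/-- partial derivative in the second variable, vector valued -/
noncomputable def ptv (f : ℝ → ℝ → ℝ × ℝ) (θ t : ℝ) : ℝ × ℝ := deriv (fun s => f θ s) t

theorem hasDerivAt_fst_of_contDiff {f : ℝ → ℝ → ℝ} (hf : ContDiff ℝ (⊤ : ℕ∞) (Function.uncurry f))
    (x t : ℝ) : HasDerivAt (fun y => f y t) (fderiv ℝ (Function.uncurry f) (x, t) (1, 0)) x := by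
  have h := (hf.differentiable (by simp) (x, t)).hasFDerivAt
  exact h.comp_hasDerivAt x ((hasDerivAt_id x).prodMk (hasDerivAt_const x t))

theorem hasDerivAt_snd_of_contDiff {f : ℝ → ℝ → ℝ} (hf : ContDiff ℝ (⊤ : ℕ∞) (Function.uncurry f))
    (x t : ℝ) : HasDerivAt (fun s => f x s) (fderiv ℝ (Function.uncurry f) (x, t) (0, 1)) t := by
  have h := (hf.differentiable (by simp) (x, t)).hasFDerivAt
  exact h.comp_hasDerivAt t ((hasDerivAt_const t x).prodMk (hasDerivAt_id t))

theorem hasDerivAt_pd {f : ℝ → ℝ → ℝ} (hf : ContDiff ℝ (⊤ : ℕ∞) (Function.uncurry f))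
    (x t : ℝ) : HasDerivAt (fun y => f y t) (pd f x t) x :=
  (hasDerivAt_fst_of_contDiff hf x t).differentiableAt.hasDerivAt

theorem hasDerivAt_pt {f : ℝ → ℝ → ℝ} (hf : ContDiff ℝ (⊤ : ℕ∞) (Function.uncurry f))
    (x t : ℝ) : HasDerivAt (fun s => f x s) (pt f x t) t :=
  (hasDerivAt_snd_of_contDiff hf x t).differentiableAt.hasDerivAt

theorem uncurry_pd {f : ℝ → ℝ → ℝ} (hf : ContDiff ℝ (⊤ : ℕ∞) (Function.uncurry f)) :
    Function.uncurry (pd f) = fun z => fderiv ℝ (Function.uncurry f) z (1, 0) :=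
  funext fun z => (hasDerivAt_fst_of_contDiff hf z.1 z.2).deriv

theorem uncurry_pt {f : ℝ → ℝ → ℝ} (hf : ContDiff ℝ (⊤ : ℕ∞) (Function.uncurry f)) :
    Function.uncurry (pt f) = fun z => fderiv ℝ (Function.uncurry f) z (0, 1) :=
  funext fun z => (hasDerivAt_snd_of_contDiff hf z.1 z.2).deriv

theorem contDiff_pd {f : ℝ → ℝ → ℝ} (hf : ContDiff ℝ (⊤ : ℕ∞) (Function.uncurry f)) :
    ContDiff ℝ (⊤ : ℕ∞) (Function.uncurry (pd f)) := by
  rw [uncurry_pd hf]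
  exact (hf.fderiv_right (by simp)).clm_apply contDiff_const

theorem contDiff_pt {f : ℝ → ℝ → ℝ} (hf : ContDiff ℝ (⊤ : ℕ∞) (Function.uncurry f)) :
    ContDiff ℝ (⊤ : ℕ∞) (Function.uncurry (pt f)) := by
  rw [uncurry_pt hf]
  exact (hf.fderiv_right (by simp)).clm_apply contDiff_const

theorem pt_pd_comm {f : ℝ → ℝ → ℝ} (hf : ContDiff ℝ (⊤ : ℕ∞) (Function.uncurry f)) (x t : ℝ) :
    pt (pd f) x t = pd (pt f) x t := by
  have hd : DifferentiableAt ℝ (fderiv ℝ (Function.uncurry f)) (x, t) :=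
    (hf.fderiv_right (m := (⊤ : ℕ∞)) (by simp)).differentiable (by simp) _
  have happ (v w : ℝ × ℝ) :
      fderiv ℝ (fun z => fderiv ℝ (Function.uncurry f) z v) (x, t) w
        = fderiv ℝ (fderiv ℝ (Function.uncurry f)) (x, t) w v := by
    rw [fderiv_clm_apply hd (differentiableAt_const v)]
    simp
  have hsymm := (hf.contDiffAt (x := (x, t))).isSymmSndFDerivAt
    (by rw [minSmoothness_of_isRCLikeNormedField]; exact WithTop.coe_le_coe.2 le_top)
  rw [pt, (hasDerivAt_snd_of_contDiff (contDiff_pd hf) x t).deriv, pd,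
    (hasDerivAt_fst_of_contDiff (contDiff_pt hf) x t).deriv, uncurry_pd hf, uncurry_pt hf,
    happ, happ]
  exact hsymm.eq _ _

/-- Chain rule along a moving first argument. -/
theorem hasDerivAt_comp_fst {f : ℝ → ℝ → ℝ} (hf : ContDiff ℝ (⊤ : ℕ∞) (Function.uncurry f))
    {θ : ℝ → ℝ} {θ' t : ℝ} (hθ : HasDerivAt θ θ' t) :
    HasDerivAt (fun s => f (θ s) s) (pd f (θ t) t * θ' + pt f (θ t) t) t := by
  have h := (hf.differentiable (by simp) (θ t, t)).hasFDerivAt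
  have hc := HasFDerivAt.comp_hasDerivAt (f := fun s => (θ s, s)) t h
    (hθ.prodMk (hasDerivAt_id t))
  have hpd : pd f (θ t) t = _ := (hasDerivAt_fst_of_contDiff hf (θ t) t).deriv
  have hpt : pt f (θ t) t = _ := (hasDerivAt_snd_of_contDiff hf (θ t) t).deriv
  have hvec : ((θ', 1) : ℝ × ℝ) = θ' • ((1, 0) : ℝ × ℝ) + (0, 1) := by simp
  rw [hvec, map_add, map_smul, ← hpd, ← hpt, smul_eq_mul, mul_comm] at hc
  exact hc

/-- Differentiation under the integral sign for smooth integrands. -/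
theorem hasDerivAt_integral_of_contDiff {f : ℝ → ℝ → ℝ}
    (hf : ContDiff ℝ (⊤ : ℕ∞) (Function.uncurry f)) (b c t : ℝ) :
    HasDerivAt (fun s => ∫ u in b..c, f u s) (∫ u in b..c, pt f u t) t := by
  have hcont (g : ℝ → ℝ → ℝ) (hg : Continuous (Function.uncurry g)) (s : ℝ) :
      Continuous fun u => g u s := hg.comp (Continuous.prodMk_left s)
  have hf' := (contDiff_pt hf).continuous
  obtain ⟨C, hC⟩ := (isCompact_uIcc.prod (isCompact_closedBall t 1)).exists_bound_of_continuousOn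
    (s := uIcc b c ×ˢ Metric.closedBall t 1) hf'.continuousOn
  refine (intervalIntegral.hasDerivAt_integral_of_dominated_loc_of_deriv_le
    (F := fun s u => f u s) (F' := fun s u => pt f u s) (bound := fun _ => C)
    (Metric.closedBall_mem_nhds t one_pos)
    (Filter.Eventually.of_forall fun s => (hcont f hf.continuous s).aestronglyMeasurable)
    ((hcont f hf.continuous t).intervalIntegrable _ _)
    (hcont _ hf' t).aestronglyMeasurable
    (Filter.Eventually.of_forall fun u hu s hs => hC (u, s) ⟨uIoc_subset_uIcc hu, hs⟩)
    intervalIntegrable_const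
    (Filter.Eventually.of_forall fun u _ s _ => hasDerivAt_pt hf u s)).2

/-- Functions that agree on `[0, T)` have the same derivative there. -/
theorem hasDerivAt_unique_of_eq_on_Ico {f g : ℝ → ℝ} {f' g' T t : ℝ} (ht : t ∈ Ico 0 T)
    (hf : HasDerivAt f f' t) (hg : HasDerivAt g g' t) (hfg : ∀ s ∈ Ico 0 T, f s = g s) :
    f' = g' := by
  refine (uniqueDiffWithinAt_Ici t).eq_deriv _ hf.hasDerivWithinAt
    (hg.hasDerivWithinAt.congr_of_eventuallyEq ?_ (hfg t ht))
  filter_upwards [self_mem_nhdsWithin, mem_nhdsWithin_of_mem_nhds (Iio_mem_nhds ht.2)] with s h1 h2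
  exact hfg s ⟨ht.1.trans h1, h2⟩

theorem pdv_eq {F : ℝ → ℝ → ℝ × ℝ} (hF : ContDiff ℝ (⊤ : ℕ∞) (Function.uncurry F)) (u t : ℝ) :
    pdv F u t = (pd (fun x s => (F x s).1) u t, pd (fun x s => (F x s).2) u t) := by
  have h1 := hasDerivAt_pd (f := fun x s => (F x s).1) (contDiff_fst.comp hF) u t
  have h2 := hasDerivAt_pd (f := fun x s => (F x s).2) (contDiff_snd.comp hF) u t
  exact (h1.prodMk h2).deriv

theorem ptv_eq {F : ℝ → ℝ → ℝ × ℝ} (hF : ContDiff ℝ (⊤ : ℕ∞) (Function.uncurry F)) (u t : ℝ) :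
    ptv F u t = (pt (fun x s => (F x s).1) u t, pt (fun x s => (F x s).2) u t) := by
  have h1 := hasDerivAt_pt (f := fun x s => (F x s).1) (contDiff_fst.comp hF) u t
  have h2 := hasDerivAt_pt (f := fun x s => (F x s).2) (contDiff_snd.comp hF) u t
  exact (h1.prodMk h2).deriv

theorem pd_periodic {f : ℝ → ℝ → ℝ} {c : ℝ} (h : ∀ x t, f (x + c) t = f x t) (x t : ℝ) :
    pd f (x + c) t = pd f x t := by
  rw [pd, pd, ← deriv_comp_add_const]
  simp only [h]

theorem pt_periodic {f : ℝ → ℝ → ℝ} {c : ℝ} (h : ∀ x t, f (x + c) t = f x t) (x t : ℝ) :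
    pt f (x + c) t = pt f x t := by
  simp only [pt, h]

/-- Differentiating the area integrand `[F, F_u]` in time. -/
theorem pt_wedge {f g : ℝ → ℝ → ℝ} (hf : ContDiff ℝ (⊤ : ℕ∞) (Function.uncurry f))
    (hg : ContDiff ℝ (⊤ : ℕ∞) (Function.uncurry g)) (u t : ℝ) :
    pt (fun u s => f u s * pd g u s - g u s * pd f u s) u t
      = 2 * (pt f u t * pd g u t - pt g u t * pd f u t)
        + pd (fun u s => f u s * pt g u s - g u s * pt f u s) u t := by
  have h1 := ((hasDerivAt_pt hf u t).mul (hasDerivAt_pt (contDiff_pd hg) u t)).sub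
    ((hasDerivAt_pt hg u t).mul (hasDerivAt_pt (contDiff_pd hf) u t))
  have h2 := ((hasDerivAt_pd hf u t).mul (hasDerivAt_pd (contDiff_pt hg) u t)).sub
    ((hasDerivAt_pd hg u t).mul (hasDerivAt_pd (contDiff_pt hf) u t))
  have e1 : pt (fun u s => f u s * pd g u s - g u s * pd f u s) u t = _ := h1.deriv
  have e2 : pd (fun u s => f u s * pt g u s - g u s * pt f u s) u t = _ := h2.deriv
  rw [e1, e2, pt_pd_comm hf, pt_pd_comm hg]
  ring

theorem contDiff_wedge {f g f' g' : ℝ → ℝ → ℝ} (hf : ContDiff ℝ (⊤ : ℕ∞) (Function.uncurry f))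
    (hg : ContDiff ℝ (⊤ : ℕ∞) (Function.uncurry g))
    (hf' : ContDiff ℝ (⊤ : ℕ∞) (Function.uncurry f'))
    (hg' : ContDiff ℝ (⊤ : ℕ∞) (Function.uncurry g')) :
    ContDiff ℝ (⊤ : ℕ∞) (Function.uncurry fun u s => f u s * g' u s - g u s * f' u s) :=
  (hf.mul hg').sub (hg.mul hf')

theorem hasDerivAt_integral_wedge {f g : ℝ → ℝ → ℝ} {c : ℝ}
    (hf : ContDiff ℝ (⊤ : ℕ∞) (Function.uncurry f)) (hg : ContDiff ℝ (⊤ : ℕ∞) (Function.uncurry g))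
    (hfper : ∀ u t, f (u + c) t = f u t) (hgper : ∀ u t, g (u + c) t = g u t) (t : ℝ) :
    HasDerivAt (fun s => ∫ u in 0..c, (f u s * pd g u s - g u s * pd f u s))
      (2 * ∫ u in 0..c, (pt f u t * pd g u t - pt g u t * pd f u t)) t := by
  have h := hasDerivAt_integral_of_contDiff
    (contDiff_wedge hf hg (contDiff_pd hf) (contDiff_pd hg)) 0 c t
  have hcont {w : ℝ → ℝ → ℝ} (hw : ContDiff ℝ (⊤ : ℕ∞) (Function.uncurry w)) :
      Continuous fun u => w u t := hw.continuous.comp (Continuous.prodMk_left t)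
  have hB := contDiff_wedge hf hg (contDiff_pt hf) (contDiff_pt hg)
  have hM := contDiff_wedge (contDiff_pt hf) (contDiff_pt hg) (contDiff_pd hf) (contDiff_pd hg)
  have hboundary :
      ∫ u in 0..c, pd (fun u s => f u s * pt g u s - g u s * pt f u s) u t = 0 := by
    rw [intervalIntegral.integral_eq_sub_of_hasDerivAt (fun u _ => hasDerivAt_pd hB u t)
      ((hcont (contDiff_pd hB)).intervalIntegrable _ _)]
    have hf0 := hfper 0 t
    have hg0 := hgper 0 t
    have hft0 := pt_periodic hfper 0 t
    have hgt0 := pt_periodic hgper 0 t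
    rw [zero_add] at hf0 hg0 hft0 hgt0
    rw [hf0, hg0, hft0, hgt0, sub_self]
  simp only [pt_wedge hf hg] at h
  rwa [intervalIntegral.integral_add (((hcont hM).const_mul 2).intervalIntegrable _ _)
    ((hcont (contDiff_pd hB)).intervalIntegrable _ _), hboundary, add_zero,
    intervalIntegral.integral_const_mul] at h

theorem stmt2
    (T : ℝ) (hT : 0 < T)
    (a : ℝ → ℝ → ℝ) (ha : ContDiff ℝ (⊤ : ℕ∞) (Function.uncurry a))
    (haper : ∀ θ t, a (θ + π) t = a θ t)
    (hapos : ∀ θ t, t ∈ Set.Ico 0 T → 0 < a θ t)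
    (haapos : ∀ θ t, t ∈ Set.Ico 0 T → 0 < a θ t + pd (pd a) θ t)
    (p q : ℝ → ℝ → ℝ × ℝ)
    (hp : ∀ θ t, p θ t = a θ t • er θ + pd a θ t • etheta θ)
    (hq : ∀ θ t, q θ t = (a θ t)⁻¹ • etheta θ)
    (F : ℝ → ℝ → ℝ × ℝ) (hF : ContDiff ℝ (⊤ : ℕ∞) (Function.uncurry F))
    (hFper : ∀ u t, F (u + 2 * π) t = F u t)
    (Θ : ℝ → ℝ → ℝ) (hΘsm : ContDiff ℝ (⊤ : ℕ∞) (Function.uncurry Θ))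
    (hΘper : ∀ u t, Θ (u + 2 * π) t = Θ u t + 2 * π)
    (hΘu : ∀ u t, t ∈ Set.Ico 0 T → 0 < pd Θ u t)
    (v : ℝ → ℝ → ℝ) (hvsm : ContDiff ℝ (⊤ : ℕ∞) (Function.uncurry v))
    (hvpos : ∀ u t, t ∈ Set.Ico 0 T → 0 < v u t)
    (k : ℝ → ℝ → ℝ)
    (hk : ∀ u t, k u t =
      a (Θ u t) t * (a (Θ u t) t + pd (pd a) (Θ u t) t) * pd Θ u t / v u t)
    (hFu : ∀ u t, t ∈ Set.Ico 0 T → pdv F u t = v u t • q (Θ u t) t)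
    (hFt : ∀ u t, t ∈ Set.Ico 0 T → ptv F u t = (-(k u t)) • p (Θ u t) t)
    (A AP L : ℝ → ℝ)
    (hA : ∀ t, A t = (1 / 2) * ∫ u in (0:ℝ)..2 * π, wedge (F u t) (pdv F u t))
    (hAP : ∀ t, AP t = (1 / 2) * ∫ θ in (0:ℝ)..2 * π, a θ t * (a θ t + pd (pd a) θ t))
    (hL : ∀ t, L t = ∫ u in (0:ℝ)..2 * π, v u t)
    (hApos : ∀ t ∈ Set.Ico 0 T, 0 < A t) :
    ∀ t ∈ Set.Ico 0 T,
      deriv (fun s => L s ^ 2 / A s) t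
        = -(2 * L t / A t) *
            ((∫ u in (0:ℝ)..2 * π, (k u t) ^ 2 * v u t) - AP t * L t / A t)
          + (2 * L t / A t) *
            ∫ u in (0:ℝ)..2 * π, pt (fun x s => Real.log (a x s)) (Θ u t) t * v u t := by
  intro t ht
  set f : ℝ → ℝ → ℝ := fun u s => (F u s).1 with hfdef
  set g : ℝ → ℝ → ℝ := fun u s => (F u s).2 with hgdef
  have hf : ContDiff ℝ (⊤ : ℕ∞) (Function.uncurry f) := contDiff_fst.comp hF
  have hg : ContDiff ℝ (⊤ : ℕ∞) (Function.uncurry g) := contDiff_snd.comp hF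
  have ha1 := contDiff_pd ha
  have ha2 := contDiff_pd ha1
  have hslice {w : ℝ → ℝ → ℝ} (hw : ContDiff ℝ (⊤ : ℕ∞) (Function.uncurry w)) (s : ℝ) :
      Continuous fun u => w u s := hw.continuous.comp (Continuous.prodMk_left s)
  have hkv (u : ℝ) : k u t * v u t
      = a (Θ u t) t * (a (Θ u t) t + pd (pd a) (Θ u t) t) * pd Θ u t := by
    rw [hk, div_mul_cancel₀ _ (hvpos u t ht).ne']
  have hf_u (u s : ℝ) (hs : s ∈ Ico 0 T) :
      a (Θ u s) s * pd f u s = -(v u s * Real.sin (Θ u s)) := by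
    have h := congrArg Prod.fst (hFu u s hs)
    rw [pdv_eq hF, hq] at h
    have hne := (hapos (Θ u s) s hs).ne'
    simp only [etheta, Prod.smul_fst, smul_eq_mul] at h
    change pd f u s = _ at h
    rw [h]
    field_simp
  have hg_u (u s : ℝ) (hs : s ∈ Ico 0 T) :
      a (Θ u s) s * pd g u s = v u s * Real.cos (Θ u s) := by
    have h := congrArg Prod.snd (hFu u s hs)
    rw [pdv_eq hF, hq] at h
    have hne := (hapos (Θ u s) s hs).ne'
    simp only [etheta, Prod.smul_snd, smul_eq_mul] at h
    change pd g u s = _ at h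
    rw [h]
    field_simp
  have hf_t (u : ℝ) : pt f u t
      = -k u t * (a (Θ u t) t * Real.cos (Θ u t) - pd a (Θ u t) t * Real.sin (Θ u t)) := by
    have h := congrArg Prod.fst (hFt u t ht)
    rw [ptv_eq hF, hp] at h
    simp only [er, etheta, Prod.smul_fst, Prod.fst_add, smul_eq_mul] at h
    change pt f u t = _ at h
    rw [h]
    ring
  have hg_t (u : ℝ) : pt g u t
      = -k u t * (a (Θ u t) t * Real.sin (Θ u t) + pd a (Θ u t) t * Real.cos (Θ u t)) := by
    have h := congrArg Prod.snd (hFt u t ht)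
    rw [ptv_eq hF, hp] at h
    simp only [er, etheta, Prod.smul_snd, Prod.snd_add, smul_eq_mul] at h
    exact h
  have hk_diff (u : ℝ) : DifferentiableAt ℝ (fun x => k x t) u := by
    have hΘd := hasDerivAt_pd hΘsm u t
    have h0 := (hasDerivAt_pd ha (Θ u t) t).comp u hΘd
    have h2 := (hasDerivAt_pd ha2 (Θ u t) t).comp u hΘd
    have hnum := (h0.mul (h0.add h2)).mul (hasDerivAt_pd (contDiff_pd hΘsm) u t)
    have h := hnum.div (hasDerivAt_pd hvsm u t) (hvpos u t ht).ne'
    have heq : (fun x => k x t) = _ := funext fun x => hk x t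
    rw [heq]
    exact h.differentiableAt
  have hv_t (u : ℝ) : pt v u t
      = -(k u t ^ 2 * v u t) + pt (fun x s => Real.log (a x s)) (Θ u t) t * v u t := by
    have hapos' := hapos (Θ u t) t ht
    have hlog : pt (fun x s => Real.log (a x s)) (Θ u t) t
        = pt a (Θ u t) t / a (Θ u t) t :=
      ((hasDerivAt_pt ha (Θ u t) t).log hapos'.ne').deriv
    have hΘt := hasDerivAt_pt hΘsm u t
    have hΘu' := hasDerivAt_pd hΘsm u t
    have hat := hasDerivAt_comp_fst ha hΘt
    have hvt := hasDerivAt_pt hvsm u t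
    have hX := hasDerivAt_unique_of_eq_on_Ico ht
      (hat.mul (hasDerivAt_pt (contDiff_pd hf) u t)) (hvt.mul hΘt.sin).neg (hf_u u)
    have hY := hasDerivAt_unique_of_eq_on_Ico ht
      (hat.mul (hasDerivAt_pt (contDiff_pd hg) u t)) (hvt.mul hΘt.cos) (hg_u u)
    have h0 := (hasDerivAt_pd ha (Θ u t) t).comp u hΘu'
    have h1 := (hasDerivAt_pd ha1 (Θ u t) t).comp u hΘu'
    have hku := (hk_diff u).hasDerivAt
    have hfut : pd (pt f) u t = _ := ((hku.neg.mul
      ((h0.mul hΘu'.cos).sub (h1.mul hΘu'.sin))).congr_of_eventuallyEq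
        (Filter.Eventually.of_forall hf_t)).deriv
    have hgut : pd (pt g) u t = _ := ((hku.neg.mul
      ((h0.mul hΘu'.sin).add (h1.mul hΘu'.cos))).congr_of_eventuallyEq
        (Filter.Eventually.of_forall hg_t)).deriv
    rw [pt_pd_comm hf, hfut] at hX
    rw [pt_pd_comm hg, hgut] at hY
    simp only [Function.comp_apply, Pi.mul_apply, Pi.add_apply, Pi.sub_apply, Pi.neg_apply]
      at hX hY
    have hxu := hf_u u t ht
    have hyu := hg_u u t ht
    have hsc := Real.sin_sq_add_cos_sq (Θ u t)
    have hkvu := hkv u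
    rw [hlog]
    generalize deriv (fun x => k x t) u = ku at hX hY
    generalize pd f u t = X at *
    generalize pd g u t = Y at *
    generalize Real.sin (Θ u t) = S at *
    generalize Real.cos (Θ u t) = C at *
    generalize pt v u t = V' at *
    generalize pt Θ u t = Θt at *
    generalize pd Θ u t = Θu at *
    generalize pt a (Θ u t) t = at' at *
    generalize pd (pd a) (Θ u t) t = a2 at *
    generalize pd a (Θ u t) t = a1 at *
    generalize a (Θ u t) t = a0 at *
    generalize k u t = K at *
    generalize v u t = w at *
    clear * - hX hY hxu hyu hsc hkvu hapos'
    have hne := hapos'.ne'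
    have hrad : a0 ^ 2 * ku = w * Θt := by
      refine mul_left_cancel₀ hne ?_
      linear_combination -a0 * (C * hX + S * hY) + (a1 * Θt + at') * (C * hxu + S * hyu)
        - a0 * (a0 ^ 2 * ku - w * Θt) * hsc
    have htan : a0 * V' = -(a0 ^ 2) * (ku * a1 + K * Θu * (a0 + a2)) + (a1 * Θt + at') * w := by
      linear_combination a0 * (S * hX - C * hY) + (a1 * Θt + at') * (C * hyu - S * hxu)
        - (a0 * V' + a0 ^ 2 * (ku * a1 + K * Θu * (a0 + a2)) - (a1 * Θt + at') * w) * hsc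
    have hmain : a0 * V' = -(a0 * (K ^ 2 * w)) + at' * w := by
      linear_combination htan - a1 * hrad + a0 * K * hkvu
    field_simp
    linear_combination hmain
  have hLd : HasDerivAt L (-(∫ u in (0:ℝ)..2 * π, (k u t) ^ 2 * v u t)
      + ∫ u in (0:ℝ)..2 * π, pt (fun x s => Real.log (a x s)) (Θ u t) t * v u t) t := by
    have h := hasDerivAt_integral_of_contDiff hvsm 0 (2 * π) t
    have hkc : Continuous fun u => k u t :=
      continuous_iff_continuousAt.2 fun u => (hk_diff u).continuousAt
    have hk2c : Continuous fun u => k u t ^ 2 * v u t := (hkc.pow 2).mul (hslice hvsm t)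
    have hlogc : Continuous fun u => pt (fun x s => Real.log (a x s)) (Θ u t) t * v u t := by
      have h := (hslice (contDiff_pt hvsm) t).add hk2c
      refine h.congr fun u => ?_
      simp only [Pi.add_apply, hv_t u]
      ring
    simp only [hv_t] at h
    rw [intervalIntegral.integral_add (hk2c.fun_neg.intervalIntegrable _ _)
      (hlogc.intervalIntegrable _ _), intervalIntegral.integral_neg] at h
    exact h.congr_of_eventuallyEq (Filter.Eventually.of_forall hL)
  have hkv_int : ∫ u in (0:ℝ)..2 * π, k u t * v u t = 2 * AP t := by
    set G : ℝ → ℝ := fun θ => a θ t * (a θ t + pd (pd a) θ t) with hG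
    have hGc : Continuous G := (hslice ha t).mul ((hslice ha t).add (hslice ha2 t))
    have hGπ : Function.Periodic G π := fun θ => by
      simp only [hG, haper, pd_periodic (pd_periodic haper)]
    have hG2π : Function.Periodic G (2 * π) := by
      simpa using hGπ.nsmul 2
    have hsub := intervalIntegral.integral_comp_mul_deriv (a := 0) (b := 2 * π)
      (fun u _ => hasDerivAt_pd hΘsm u t) (hslice (contDiff_pd hΘsm) t).continuousOn hGc
    have hΘ0 := hΘper 0 t
    rw [zero_add] at hΘ0
    rw [hΘ0, hG2π.intervalIntegral_add_eq (Θ 0 t) 0, zero_add] at hsub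
    rw [hAP]
    simp only [hkv]
    calc _ = _ := hsub
      _ = _ := by ring
  have hAd : HasDerivAt A (-2 * AP t) t := by
    have hfper (u s : ℝ) : f (u + 2 * π) s = f u s := congrArg Prod.fst (hFper u s)
    have hgper (u s : ℝ) : g (u + 2 * π) s = g u s := congrArg Prod.snd (hFper u s)
    have h := (hasDerivAt_integral_wedge hf hg hfper hgper t).const_mul (1 / 2)
    have hpoint (u : ℝ) : pt f u t * pd g u t - pt g u t * pd f u t = -(k u t * v u t) := by
      have hne := (hapos (Θ u t) t ht).ne'
      have hX := hf_u u t ht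
      have hY := hg_u u t ht
      have hsc := Real.sin_sq_add_cos_sq (Θ u t)
      rw [hf_t, hg_t]
      refine mul_left_cancel₀ hne ?_
      linear_combination
        -k u t * (a (Θ u t) t * Real.cos (Θ u t) - pd a (Θ u t) t * Real.sin (Θ u t)) * hY
        + k u t * (a (Θ u t) t * Real.sin (Θ u t) + pd a (Θ u t) t * Real.cos (Θ u t)) * hX
        - k u t * v u t * a (Θ u t) t * hsc
    simp only [hpoint] at h
    rw [intervalIntegral.integral_neg, hkv_int] at h
    have hA' (s : ℝ) : A s
        = 1 / 2 * ∫ u in (0:ℝ)..2 * π, (f u s * pd g u s - g u s * pd f u s) := by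
      rw [hA]
      simp only [wedge, pdv_eq hF, hfdef, hgdef]
    exact (h.congr_of_eventuallyEq (Filter.Eventually.of_forall hA')).congr_deriv (by ring)
  have hApos' := (hApos t ht).ne'
  have hderiv : deriv (fun s => L s ^ 2 / A s) t = _ := ((hLd.pow 2).div hAd hApos').deriv
  rw [hderiv]
  simp only [Pi.pow_apply]
  field_simp
  ring
end

section
/- Define g : [0,T) → ℝ by g(t) = ∫₀^{2π} ( a₀k )²(θ,t) − ( (a₀k)' )²(θ,t) + 2a₀(θ)(a₀(θ)+a₀''(θ))·log k(θ,t)·(f'(t)/f(t)) dθ, where (a₀k)' = ∂/∂θ(a₀(θ)k(θ,t)). Then for all t ∈ [0,T), g'(t) = ∫₀^{2π} ( 2a₀(a₀+a₀'')/k² )·( ∂k/∂t )² + 2a₀(a₀+a₀'')·log k·(d²/dt²)(log f)(t) dθ. -/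
open Real Set

open Topology in
/-- Differentiation under an interval integral whose integrand has a jointly continuous derivative
near the parameter. -/
theorem hasDerivAt_intervalIntegral_of_continuousOn {F F' : ℝ → ℝ → ℝ} {a b t : ℝ} {U : Set ℝ}
    (hU : U ∈ 𝓝 t) (hF : ∀ s ∈ U, ContinuousOn (F s) (uIcc a b))
    (hF' : ContinuousOn (Function.uncurry F') (U ×ˢ uIcc a b))
    (hd : ∀ s ∈ U, ∀ θ ∈ uIcc a b, HasDerivAt (fun s => F s θ) (F' s θ) s) :
    HasDerivAt (fun s => ∫ θ in a..b, F s θ) (∫ θ in a..b, F' t θ) t := by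
  obtain ⟨ε, hε, hεU⟩ := Metric.nhds_basis_closedBall.mem_iff.1 hU
  obtain ⟨C, hC⟩ := ((isCompact_closedBall t ε).prod isCompact_uIcc).exists_bound_of_continuousOn
    (hF'.mono (prod_mono hεU subset_rfl))
  have hB : Metric.closedBall t ε ∈ 𝓝 t := Metric.closedBall_mem_nhds t hε
  have htU : t ∈ U := mem_of_mem_nhds hU
  have hF't : ContinuousOn (F' t) (uIcc a b) :=
    hF'.comp (f := fun θ => (t, θ)) (by fun_prop) fun θ hθ => ⟨htU, hθ⟩
  refine (intervalIntegral.hasDerivAt_integral_of_dominated_loc_of_deriv_le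
    (bound := fun _ => C) hB ?_ (hF t htU).intervalIntegrable ?_ ?_ (by simp) ?_).2
  · filter_upwards [hU] with s hs
    exact ((hF s hs).mono uIoc_subset_uIcc).aestronglyMeasurable measurableSet_uIoc
  · exact (hF't.mono uIoc_subset_uIcc).aestronglyMeasurable measurableSet_uIoc
  · exact .of_forall fun θ hθ s hs => hC (s, θ) ⟨hs, uIoc_subset_uIcc hθ⟩
  · exact .of_forall fun θ hθ s hs => hd s (hεU hs) θ (uIoc_subset_uIcc hθ)

section PartialDerivatives

variable {h : ℝ → ℝ → ℝ}

theorem hasDerivAt_fst_fderiv (hh : Differentiable ℝ (Function.uncurry h)) (θ t : ℝ) :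
    HasDerivAt (fun x => h x t) (fderiv ℝ (Function.uncurry h) (θ, t) (1, 0)) θ :=
  (hh (θ, t)).hasFDerivAt.comp_hasDerivAt (f := fun x => (x, t)) θ
    ((hasDerivAt_id θ).prodMk (hasDerivAt_const θ t))

theorem hasDerivAt_snd_fderiv (hh : Differentiable ℝ (Function.uncurry h)) (θ t : ℝ) :
    HasDerivAt (fun s => h θ s) (fderiv ℝ (Function.uncurry h) (θ, t) (0, 1)) t :=
  (hh (θ, t)).hasFDerivAt.comp_hasDerivAt (f := fun s => (θ, s)) t
    ((hasDerivAt_const t θ).prodMk (hasDerivAt_id t))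

theorem hasDerivAt_pd_s14 (hh : Differentiable ℝ (Function.uncurry h)) (θ t : ℝ) :
    HasDerivAt (fun x => h x t) (pd h θ t) θ :=
  (hasDerivAt_fst_fderiv hh θ t).differentiableAt.hasDerivAt

theorem hasDerivAt_pt_s14 (hh : Differentiable ℝ (Function.uncurry h)) (θ t : ℝ) :
    HasDerivAt (fun s => h θ s) (pt h θ t) t :=
  (hasDerivAt_snd_fderiv hh θ t).differentiableAt.hasDerivAt

theorem pd_eq_fderiv (hh : Differentiable ℝ (Function.uncurry h)) :
    pd h = fun θ t => fderiv ℝ (Function.uncurry h) (θ, t) (1, 0) :=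
  funext₂ fun θ t => (hasDerivAt_fst_fderiv hh θ t).deriv

theorem pt_eq_fderiv (hh : Differentiable ℝ (Function.uncurry h)) :
    pt h = fun θ t => fderiv ℝ (Function.uncurry h) (θ, t) (0, 1) :=
  funext₂ fun θ t => (hasDerivAt_snd_fderiv hh θ t).deriv

theorem contDiff_fderiv_apply_const (hh : ContDiff ℝ (⊤ : ℕ∞) (Function.uncurry h)) (v : ℝ × ℝ) :
    ContDiff ℝ (⊤ : ℕ∞) fun p => fderiv ℝ (Function.uncurry h) p v :=
  (hh.fderiv_right (m := (⊤ : ℕ∞)) (by simp)).clm_apply contDiff_const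

theorem contDiff_pd_s14 (hh : ContDiff ℝ (⊤ : ℕ∞) (Function.uncurry h)) :
    ContDiff ℝ (⊤ : ℕ∞) (Function.uncurry (pd h)) := by
  rw [pd_eq_fderiv (hh.differentiable (by simp))]
  exact contDiff_fderiv_apply_const hh _

theorem contDiff_pt_s14 (hh : ContDiff ℝ (⊤ : ℕ∞) (Function.uncurry h)) :
    ContDiff ℝ (⊤ : ℕ∞) (Function.uncurry (pt h)) := by
  rw [pt_eq_fderiv (hh.differentiable (by simp))]
  exact contDiff_fderiv_apply_const hh _

/-- Symmetry of the mixed second partial derivatives. -/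
theorem pt_pd_eq_pd_pt (hh : ContDiff ℝ (⊤ : ℕ∞) (Function.uncurry h)) :
    pt (pd h) = pd (pt h) := by
  have hd := hh.differentiable (by simp)
  rw [pt_eq_fderiv ((contDiff_pd_s14 hh).differentiable (by simp)),
    pd_eq_fderiv ((contDiff_pt_s14 hh).differentiable (by simp)), pd_eq_fderiv hd, pt_eq_fderiv hd]
  funext θ t
  have hf : DifferentiableAt ℝ (fderiv ℝ (Function.uncurry h)) (θ, t) :=
    (hh.fderiv_right (m := (⊤ : ℕ∞)) (by simp)).differentiable (by simp) _
  have key (v w : ℝ × ℝ) : fderiv ℝ (fun p => fderiv ℝ (Function.uncurry h) p v) (θ, t) w =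
      fderiv ℝ (fderiv ℝ (Function.uncurry h)) (θ, t) w v := by
    rw [fderiv_clm_apply hf (differentiableAt_const v)]
    simp
  have hsymm : IsSymmSndFDerivAt ℝ (Function.uncurry h) (θ, t) :=
    by
    refine hh.contDiffAt.isSymmSndFDerivAt ?_
    rw [minSmoothness_of_isRCLikeNormedField]
    exact WithTop.coe_le_coe.2 (le_top : (2 : ℕ∞) ≤ ⊤)
  exact (key _ _).trans ((hsymm _ _).trans (key _ _).symm)

theorem pd_add_period {c : ℝ} (hper : ∀ θ t, h (θ + c) t = h θ t) (θ t : ℝ) :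
    pd h (θ + c) t = pd h θ t := by
  simp only [pd, ← deriv_comp_add_const, hper]

theorem pt_add_period {c : ℝ} (hper : ∀ θ t, h (θ + c) t = h θ t) (θ t : ℝ) :
    pt h (θ + c) t = pt h θ t := by
  simp only [pt, hper]

/-- Integration by parts over a period. -/
theorem integral_pd_mul_pt_pd {c : ℝ} (hh : ContDiff ℝ (⊤ : ℕ∞) (Function.uncurry h))
    (hper : ∀ θ t, h (θ + c) t = h θ t) (t : ℝ) :
    ∫ θ in (0 : ℝ)..c, pd h θ t * pt (pd h) θ t = -∫ θ in (0 : ℝ)..c, pd (pd h) θ t * pt h θ t := by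
  have hslice {u : ℝ → ℝ → ℝ} (hu : ContDiff ℝ (⊤ : ℕ∞) (Function.uncurry u)) :
      Continuous fun θ => u θ t := hu.continuous.comp (by fun_prop : Continuous fun θ => (θ, t))
  rw [pt_pd_eq_pd_pt hh, intervalIntegral.integral_mul_deriv_eq_deriv_mul
    (fun θ _ => hasDerivAt_pd_s14 ((contDiff_pd_s14 hh).differentiable (by simp)) θ t)
    (fun θ _ => hasDerivAt_pd_s14 ((contDiff_pt_s14 hh).differentiable (by simp)) θ t)
    ((hslice (contDiff_pd_s14 (contDiff_pd_s14 hh))).intervalIntegrable _ _)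
    ((hslice (contDiff_pd_s14 (contDiff_pt_s14 hh))).intervalIntegrable _ _)]
  have h1 := pd_add_period hper 0 t
  have h2 := pt_add_period hper 0 t
  rw [zero_add] at h1 h2
  rw [h1, h2]
  ring

end PartialDerivatives


theorem stmt14
    (a₀ : ℝ → ℝ) (ha₀ : ContDiff ℝ (⊤ : ℕ∞) a₀)
    (ha₀per : ∀ θ, a₀ (θ + π) = a₀ θ)
    (ha₀pos : ∀ θ, 0 < a₀ θ)
    (ha₀apos : ∀ θ, 0 < a₀ θ + deriv (deriv a₀) θ)
    (f : ℝ → ℝ) (hf : ContDiff ℝ (⊤ : ℕ∞) f)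
    (hfpos : ∀ t, 0 ≤ t → 0 < f t)
    (hfmono : MonotoneOn f (Set.Ici 0))
    (hf0 : f 0 = 1)
    (T : ℝ) (hT : 0 < T)
    (k : ℝ → ℝ → ℝ) (hksm : ContDiff ℝ (⊤ : ℕ∞) (Function.uncurry k))
    (hkper : ∀ θ t, k (θ + 2 * π) t = k θ t)
    (hkpos : ∀ θ t, t ∈ Set.Ico 0 T → 0 < k θ t)
    (hkevol : ∀ θ t, t ∈ Set.Ico 0 T →
      pt k θ t =
        a₀ θ / (a₀ θ + deriv (deriv a₀) θ) * (k θ t) ^ 2 * pd (pd k) θ t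
          + 2 * deriv a₀ θ / (a₀ θ + deriv (deriv a₀) θ) * (k θ t) ^ 2 * pd k θ t
          + (k θ t) ^ 3
          + deriv f t / f t * k θ t)
    (g : ℝ → ℝ)
    (hg : ∀ t, g t = ∫ θ in (0:ℝ)..2 * π,
      (a₀ θ * k θ t) ^ 2 - (deriv (fun x => a₀ x * k x t) θ) ^ 2
        + 2 * a₀ θ * (a₀ θ + deriv (deriv a₀) θ) * Real.log (k θ t) * (deriv f t / f t)) :
    ∀ t ∈ Set.Ico 0 T,
      deriv g t = ∫ θ in (0:ℝ)..2 * π,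
        2 * a₀ θ * (a₀ θ + deriv (deriv a₀) θ) / (k θ t) ^ 2 * (pt k θ t) ^ 2
          + 2 * a₀ θ * (a₀ θ + deriv (deriv a₀) θ) * Real.log (k θ t) *
              deriv (deriv (fun s => Real.log (f s))) t := by
  intro t ht
  have hπper (θ : ℝ) : a₀ (θ + 2 * π) = a₀ θ := by
    rw [two_mul, ← add_assoc, ha₀per, ha₀per]
  have ha' : ContDiff ℝ (⊤ : ℕ∞) (deriv a₀) := ha₀.iterate_deriv 1
  have ha'' : ContDiff ℝ (⊤ : ℕ∞) (deriv (deriv a₀)) := ha₀.iterate_deriv 2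
  have hf' : ContDiff ℝ (⊤ : ℕ∞) (deriv f) := hf.iterate_deriv 1
  have hf'' : ContDiff ℝ (⊤ : ℕ∞) (deriv (deriv f)) := hf.iterate_deriv 2
  have hac : Continuous a₀ := ha₀.continuous
  have hac'' : Continuous (deriv (deriv a₀)) := ha''.continuous
  have had (θ : ℝ) : HasDerivAt a₀ (deriv a₀ θ) θ :=
    (ha₀.differentiable (by simp) θ).hasDerivAt
  have had' (θ : ℝ) : HasDerivAt (deriv a₀) (deriv (deriv a₀) θ) θ :=
    (ha'.differentiable (by simp) θ).hasDerivAt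
  have hfd (s : ℝ) : HasDerivAt f (deriv f s) s := (hf.differentiable (by simp) s).hasDerivAt
  have hfd' (s : ℝ) : HasDerivAt (deriv f) (deriv (deriv f) s) s :=
    (hf'.differentiable (by simp) s).hasDerivAt
  have hkd := hksm.differentiable (by simp)
  let h : ℝ → ℝ → ℝ := fun θ s => a₀ θ * k θ s
  have hh : ContDiff ℝ (⊤ : ℕ∞) (Function.uncurry h) := (ha₀.comp contDiff_fst).mul hksm
  have hhd := hh.differentiable (by simp)
  have hhper (θ s : ℝ) : h (θ + 2 * π) s = h θ s := by simp only [h, hπper, hkper]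
  have hpth (θ s : ℝ) : pt h θ s = a₀ θ * pt k θ s :=
    ((hasDerivAt_pt_s14 hkd θ s).const_mul (a₀ θ)).deriv
  have hpdh : pd h = fun θ s => deriv a₀ θ * k θ s + a₀ θ * pd k θ s :=
    funext₂ fun θ s => ((had θ).mul (hasDerivAt_pd_s14 hkd θ s)).deriv
  have hpdpdh (θ s : ℝ) : pd (pd h) θ s =
      deriv (deriv a₀) θ * k θ s + deriv a₀ θ * pd k θ s +
        (deriv a₀ θ * pd k θ s + a₀ θ * pd (pd k) θ s) := by
    rw [hpdh]
    exact (((had' θ).mul (hasDerivAt_pd_s14 hkd θ s)).add ((had θ).mul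
      (hasDerivAt_pd_s14 ((contDiff_pd_s14 hksm).differentiable (by simp)) θ s))).deriv
  have hcont {u : ℝ → ℝ → ℝ} (hu : ContDiff ℝ (⊤ : ℕ∞) (Function.uncurry u)) :
      Continuous fun p : ℝ × ℝ => u p.2 p.1 := hu.continuous.comp continuous_swap
  have hck := hcont hksm
  have hcptk := hcont (contDiff_pt_s14 hksm)
  have hch := hcont hh
  have hcpdh := hcont (contDiff_pd_s14 hh)
  have hcpth := hcont (contDiff_pt_s14 hh)
  have hcptpdh := hcont (contDiff_pt_s14 (contDiff_pd_s14 hh))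
  have hcpdpdh := hcont (contDiff_pd_s14 (contDiff_pd_s14 hh))
  have hft : 0 < f t := hfpos t ht.1
  have hkU : ∀ᶠ s in nhds t, ∀ θ ∈ uIcc 0 (2 * π), 0 < k θ s :=
    isCompact_uIcc.eventually_forall_of_forall_eventually fun θ _ =>
      hck.continuousAt.eventually_const_lt (hkpos θ t ht)
  have hfU : ∀ᶠ s in nhds t, 0 < f s := hf.continuous.continuousAt.eventually_const_lt hft
  have hlog : deriv (deriv fun s => Real.log (f s)) t =
      (deriv (deriv f) t * f t - deriv f t * deriv f t) / f t ^ 2 := by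
    have hev : deriv (fun s => Real.log (f s)) =ᶠ[nhds t] fun s => deriv f s / f s := by
      filter_upwards [hfU] with s hs
      exact ((hfd s).log hs.ne').deriv
    rw [hev.deriv_eq]
    exact ((hfd' t).div (hfd t) hft.ne').deriv
  let w : ℝ → ℝ := fun θ => 2 * a₀ θ * (a₀ θ + deriv (deriv a₀) θ)
  have hw : Continuous w := by fun_prop
  let q' : ℝ → ℝ := fun s => (deriv (deriv f) s * f s - deriv f s * deriv f s) / f s ^ 2
  let F : ℝ → ℝ → ℝ := fun s θ =>
    h θ s ^ 2 - pd h θ s ^ 2 + w θ * Real.log (k θ s) * (deriv f s / f s)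
  let F' : ℝ → ℝ → ℝ := fun s θ =>
    2 * h θ s * pt h θ s - 2 * (pd h θ s * pt (pd h) θ s) +
      (w θ * (pt k θ s / k θ s) * (deriv f s / f s) + w θ * Real.log (k θ s) * q' s)
  have hfc := hf.continuous
  have hfc' := hf'.continuous
  have hfc'' := hf''.continuous
  have hderiv : HasDerivAt (fun s => ∫ θ in (0 : ℝ)..2 * π, F s θ)
      (∫ θ in (0 : ℝ)..2 * π, F' t θ) t := by
    refine hasDerivAt_intervalIntegral_of_continuousOn (hkU.and hfU) ?_ ?_ ?_
    · rintro s ⟨hks, hfs⟩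
      have hcs {u : ℝ → ℝ → ℝ} (hu : Continuous fun p : ℝ × ℝ => u p.2 p.1) :
          Continuous fun θ => u θ s := hu.comp (by fun_prop : Continuous fun θ => (s, θ))
      have hl : ContinuousOn (fun θ => Real.log (k θ s)) (uIcc 0 (2 * π)) :=
        ContinuousOn.log (hcs hck).continuousOn fun θ hθ => (hks θ hθ).ne'
      exact ((((hcs hch).pow 2).sub ((hcs hcpdh).pow 2)).continuousOn).add
        ((hw.continuousOn.mul hl).mul continuousOn_const)
    · set S : Set (ℝ × ℝ) := {s | (∀ θ ∈ uIcc 0 (2 * π), 0 < k θ s) ∧ 0 < f s} ×ˢ uIcc 0 (2 * π)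
      have hk0 : ∀ p ∈ S, k p.2 p.1 ≠ 0 := fun p hp => (hp.1.1 p.2 hp.2).ne'
      have hf0 : ∀ p ∈ S, f p.1 ≠ 0 := fun p hp => hp.1.2.ne'
      have hf1 : Continuous fun p : ℝ × ℝ => f p.1 := hfc.comp continuous_fst
      have hf1' : Continuous fun p : ℝ × ℝ => deriv f p.1 := hfc'.comp continuous_fst
      have hf1'' : Continuous fun p : ℝ × ℝ => deriv (deriv f) p.1 := hfc''.comp continuous_fst
      have hw2 : ContinuousOn (fun p : ℝ × ℝ => w p.2) S :=
        (hw.comp continuous_snd).continuousOn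
      have hl : ContinuousOn (fun p : ℝ × ℝ => Real.log (k p.2 p.1)) S :=
        ContinuousOn.log hck.continuousOn hk0
      have hq' : ContinuousOn (fun p : ℝ × ℝ => q' p.1) S :=
        ContinuousOn.div ((hf1''.mul hf1).sub (hf1'.mul hf1')).continuousOn
          (hf1.pow 2).continuousOn fun p hp => pow_ne_zero 2 (hf0 p hp)
      exact ((((continuous_const.mul hch).mul hcpth).sub
        (continuous_const.mul (hcpdh.mul hcptpdh))).continuousOn).add
        (((hw2.mul (hcptk.continuousOn.div hck.continuousOn hk0)).mul
          (hf1'.continuousOn.div hf1.continuousOn hf0)).add ((hw2.mul hl).mul hq'))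
    · rintro s ⟨hks, hfs⟩ θ hθ
      have e1 := (hasDerivAt_pt_s14 hhd θ s).pow 2
      have e2 := (hasDerivAt_pt_s14 ((contDiff_pd_s14 hh).differentiable (by simp)) θ s).pow 2
      have e3 := (((hasDerivAt_pt_s14 hkd θ s).log (hks θ hθ).ne').const_mul (w θ)).mul
        ((hfd' s).div (hfd s) hfs.ne')
      refine ((e1.sub e2).add e3).congr_deriv ?_
      simp only [F', q', Nat.cast_ofNat, Nat.add_one_sub_one, pow_one, Pi.div_apply]
      ring
  rw [show g = fun s => ∫ θ in (0 : ℝ)..2 * π, F s θ from funext hg, hderiv.deriv]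
  have hcs {u : ℝ → ℝ → ℝ} (hu : Continuous fun p : ℝ × ℝ => u p.2 p.1) :
      Continuous fun θ => u θ t := hu.comp (by fun_prop : Continuous fun θ => (t, θ))
  have hkt (θ : ℝ) : k θ t ≠ 0 := (hkpos θ t ht).ne'
  let R : ℝ → ℝ := fun θ => 2 * h θ t * pt h θ t +
    (w θ * (pt k θ t / k θ t) * (deriv f t / f t) + w θ * Real.log (k θ t) * q' t)
  have hR : Continuous R := by
    have hl : Continuous fun θ => Real.log (k θ t) := (hcs hck).log hkt
    exact ((continuous_const.mul (hcs hch)).mul (hcs hcpth)).add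
      (((hw.mul ((hcs hcptk).div (hcs hck) hkt)).mul continuous_const).add
        ((hw.mul hl).mul continuous_const))
  have hI : Continuous fun θ => 2 * (pd h θ t * pt (pd h) θ t) :=
    continuous_const.mul ((hcs hcpdh).mul (hcs hcptpdh))
  have hJ : Continuous fun θ => 2 * (pd (pd h) θ t * pt h θ t) :=
    continuous_const.mul ((hcs hcpdpdh).mul (hcs hcpth))
  calc ∫ θ in (0 : ℝ)..2 * π, F' t θ
      = ∫ θ in (0 : ℝ)..2 * π, (R θ - 2 * (pd h θ t * pt (pd h) θ t)) := by
        congr 1; funext θ; simp only [F', R]; ring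
    _ = ∫ θ in (0 : ℝ)..2 * π, (R θ + 2 * (pd (pd h) θ t * pt h θ t)) := by
        rw [intervalIntegral.integral_sub (hR.intervalIntegrable _ _)
            (hI.intervalIntegrable _ _),
          intervalIntegral.integral_add (hR.intervalIntegrable _ _)
            (hJ.intervalIntegrable _ _),
          intervalIntegral.integral_const_mul, intervalIntegral.integral_const_mul,
          integral_pd_mul_pt_pd hh hhper]
        ring
    _ = _ := by
        congr 1
        funext θ
        have hk := hkt θ
        have hA := (ha₀apos θ).ne'
        have hev : (a₀ θ + deriv (deriv a₀) θ) * pt k θ t =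
            k θ t ^ 2 * (a₀ θ * pd (pd k) θ t + 2 * deriv a₀ θ * pd k θ t +
              (a₀ θ + deriv (deriv a₀) θ) * k θ t) +
            (a₀ θ + deriv (deriv a₀) θ) * (deriv f t / f t) * k θ t := by
          rw [hkevol θ t ht]
          generalize deriv f t / f t = r
          field_simp
        rw [hlog, hpdpdh, hpth]
        simp only [R, w, h, hpth]
        have hsq : 2 * a₀ θ * (a₀ θ + deriv (deriv a₀) θ) / k θ t ^ 2 * pt k θ t ^ 2 =
            2 * a₀ θ * pt k θ t / k θ t ^ 2 * ((a₀ θ + deriv (deriv a₀) θ) * pt k θ t) := by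
          ring
        rw [hsq, hev]
        simp only [q']
        generalize deriv f t / f t = r
        field_simp
        ring
end
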